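/- Let g ∈ GT_λ and x = ς_λ(g). Then for every 1 ≤ i ≤ n, max_{1 ≤ j ≤ n} σ_j^{(i)}(g) = σ^{(i)}(x); consequently, since σ^{(i)}(x) ≥ σ_0^{(i)}(x), one has max( σ^{(i)}(x), σ_0^{(i)}(x) ) = max_{1 ≤ j ≤ n} σ_j^{(i)}(g). -/

import Mathlib

namespace PolyReal

/-- Cartan integers `⟨α_s^∨, α_t⟩` of type `A_n`. -/
def coef (s t : ℕ) : ℤ :=
  if s = t then 2 else if s + 1 = t ∨ t + 1 = s then -1 else 0

/-- Colour of position `k ≥ 1` for the periodic sequence `ι = (…, n, …, 2, 1)`: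
position `k = (j-1)n + i` has colour `i`. -/
def col (n k : ℕ) : ℕ := (k - 1) % n + 1

/-- The component `x_j^{(i)} = x_{(j-1)n+i}`, with the conventions
`x_j^{(0)} := 0` and `x_j^{(n+1)} := 0` (indices out of `1 ≤ i ≤ n` give `0`). -/
def Xc (n : ℕ) (x : ℕ → ℤ) (i j : ℕ) : ℤ :=
  if 1 ≤ i ∧ i ≤ n ∧ 1 ≤ j then x ((j - 1) * n + i) else 0

/-- Membership in `Σ_ι`: the chains `x_1^{(i)} ≥ x_2^{(i-1)} ≥ ⋯ ≥ x_i^{(1)} ≥ 0`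
for `1 ≤ i ≤ n`, together with `x_j^{(i)} = 0` for `i + j > n + 1`
(and `x 0 = 0`, since sequences are indexed by positions `k ≥ 1`). -/
def InSigma (n : ℕ) (x : ℕ → ℤ) : Prop :=
  x 0 = 0 ∧
  (∀ i k, 1 ≤ i → i ≤ n → 1 ≤ k → k ≤ i →
    Xc n x (i - k) (k + 1) ≤ Xc n x (i + 1 - k) k) ∧
  (∀ i j, 1 ≤ i → i ≤ n → 1 ≤ j → n + 1 < i + j → Xc n x i j = 0)

/-- Membership in `Σ_ι[λ]`. -/
def InSigmaL (n : ℕ) (lam : ℕ → ℤ) (x : ℕ → ℤ) : Prop :=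
  InSigma n x ∧
  ∀ i j, 1 ≤ j → j ≤ i → i ≤ n →
    Xc n x (i - j + 1) j - Xc n x (i - j) j ≤ lam i - lam (i + 1)

/-- Hypotheses on `λ`: `λ_1 ≥ λ_2 ≥ ⋯ ≥ λ_n (≥ 0)` and `λ_{n+1} = 0`. -/
def IsShape (n : ℕ) (lam : ℕ → ℤ) : Prop :=
  (∀ i, 1 ≤ i → i ≤ n → lam (i + 1) ≤ lam i) ∧ lam (n + 1) = 0

/-- `σ_k(x) = x_k + Σ_{l>k} ⟨α_{i_k}^∨, α_{i_l}⟩ x_l`.  For every sequence occurring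
below the support is contained in positions `≤ n²`, so the sum may be truncated
at `n² + n`. -/
def sig (n : ℕ) (x : ℕ → ℤ) (k : ℕ) : ℤ :=
  x k + ∑ l ∈ Finset.Ioc k (n * n + n), coef (col n k) (col n l) * x l

/-- `σ^{(i)}(x) = max_{k : i_k = i} σ_k(x)`; for the sequences considered here this
maximum is attained among the positions `(j-1)n + i` with `1 ≤ j ≤ n+1`
(`σ` vanishes at all later positions of colour `i`). -/
def sigmaI (n : ℕ) (x : ℕ → ℤ) (i : ℕ) : ℤ :=
  Finset.sup' (Finset.Icc 1 (n + 1)) (Finset.nonempty_Icc.mpr (by omega))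
    (fun j => sig n x ((j - 1) * n + i))

/-- `M^{(i)}(x) = { k : i_k = i, σ_k(x) = σ^{(i)}(x) }`. -/
def Mset (n : ℕ) (x : ℕ → ℤ) (i : ℕ) : Set ℕ :=
  {k | 1 ≤ k ∧ col n k = i ∧ sig n x k = sigmaI n x i}

/-- `σ_0^{(i)}(x) = -(λ_i - λ_{i+1}) + Σ_{l ≥ 1} ⟨α_i^∨, α_{i_l}⟩ x_l`
(again with the sum truncated beyond the support). -/
def sigma0 (n : ℕ) (lam : ℕ → ℤ) (x : ℕ → ℤ) (i : ℕ) : ℤ :=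
  -(lam i - lam (i + 1)) + ∑ l ∈ Finset.Icc 1 (n * n + n), coef i (col n l) * x l

/-- The elementary sequence `e_k`. -/
def eVec (k : ℕ) : ℕ → ℤ := fun l => if l = k then 1 else 0

/-- `Λ_i^{(k)}(x) = x_k^{(i-1)} + λ_{k+i-1}`, set to `0` when `k > n+2-i`. -/
def Lam (n : ℕ) (lam : ℕ → ℤ) (x : ℕ → ℤ) (i k : ℕ) : ℤ :=
  if 1 ≤ k ∧ k ≤ n + 2 - i then Xc n x (i - 1) k + lam (k + i - 1) else 0

/-- A z-array: a family of nonnegative integers indexed by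
`1 ≤ m ≤ n`, `1 ≤ k ≤ n+1-m` (and `0` outside this index range). -/
def IsZArray (n : ℕ) (Z : ℕ → ℕ → ℤ) : Prop :=
  (∀ m k, 1 ≤ m → m ≤ n → 1 ≤ k → k ≤ n + 1 - m → 0 ≤ Z m k) ∧
  (∀ m k, ¬(1 ≤ m ∧ m ≤ n ∧ 1 ≤ k ∧ k ≤ n + 1 - m) → Z m k = 0)

/-- `ψ_∞(Z)`: the sequence with `x_j^{(i)} = Σ_{k=1}^{i} z(n+2-i-j, k)` for
`i + j ≤ n+1` and `x_j^{(i)} = 0` for `i + j > n+1`.  (For a position `p ≥ 1`,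
`i = (p-1) % n + 1` and `j = (p-1)/n + 1`.) -/
def psiInf (n : ℕ) (Z : ℕ → ℕ → ℤ) : ℕ → ℤ := fun p =>
  if p = 0 then 0
  else if (p - 1) % n + 1 + ((p - 1) / n + 1) ≤ n + 1 then
    ∑ k ∈ Finset.Icc 1 ((p - 1) % n + 1),
      Z (n + 2 - ((p - 1) % n + 1) - ((p - 1) / n + 1)) k
  else 0

/-- Reverse semistandard Young tableaux of shape `λ` with entries in `{1, …, n+1}`:
row `j` (for `1 ≤ j ≤ n`) has boxes in columns `1, …, λ_j`; entries are weakly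
decreasing along rows and strictly decreasing down columns; `T` is `0` outside
the diagram. -/
def IsRSSYT (n : ℕ) (lam : ℕ → ℤ) (T : ℕ → ℕ → ℕ) : Prop :=
  (∀ j c : ℕ, 1 ≤ j → j ≤ n → 1 ≤ c → (c : ℤ) ≤ lam j → 1 ≤ T j c ∧ T j c ≤ n + 1) ∧
  (∀ j c : ℕ, 1 ≤ j → j ≤ n → 1 ≤ c → (c : ℤ) + 1 ≤ lam j → T j (c + 1) ≤ T j c) ∧
  (∀ j c : ℕ, 1 ≤ j → j + 1 ≤ n → 1 ≤ c → (c : ℤ) ≤ lam (j + 1) → T (j + 1) c < T j c) ∧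
  (∀ j c : ℕ, ¬(1 ≤ j ∧ j ≤ n ∧ 1 ≤ c ∧ (c : ℤ) ≤ lam j) → T j c = 0)

/-- `Λ_i^{(j)}(T) = #{ c : 1 ≤ c ≤ λ_j, T(j,c) ≥ i }`, as a natural number. -/
def LamTN (lam : ℕ → ℤ) (T : ℕ → ℕ → ℕ) (i j : ℕ) : ℕ :=
  ((Finset.Icc 1 (lam j).toNat).filter (fun c => i ≤ T j c)).card

/-- `Λ_i^{(j)}(T)`, as an integer. -/
def LamT (lam : ℕ → ℤ) (T : ℕ → ℕ → ℕ) (i j : ℕ) : ℤ := (LamTN lam T i j : ℤ)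

/-- The number of boxes of `T` containing the entry `i`. -/
def countEntry (n : ℕ) (lam : ℕ → ℤ) (T : ℕ → ℕ → ℕ) (i : ℕ) : ℤ :=
  ∑ j ∈ Finset.Icc 1 n,
    (((Finset.Icc 1 (lam j).toNat).filter (fun c => T j c = i)).card : ℤ)

/-- Gelfand–Tsetlin patterns of shape `λ`: `g i k` is `y_k^{(i)}`, defined for
`0 ≤ i ≤ n`, `1 ≤ k ≤ n+1-i` (and `0` outside this index range), with
`y_k^{(0)} = λ_k` and the interlacing inequalities. -/
def IsGT (n : ℕ) (lam : ℕ → ℤ) (g : ℕ → ℕ → ℤ) : Prop :=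
  (∀ i k, i ≤ n → 1 ≤ k → k ≤ n + 1 - i → 0 ≤ g i k) ∧
  (∀ k, 1 ≤ k → k ≤ n + 1 → g 0 k = lam k) ∧
  (∀ i k, 1 ≤ i → i ≤ n → 1 ≤ k → k ≤ n + 1 - i →
    g i k ≤ g (i - 1) k ∧ g (i - 1) (k + 1) ≤ g i k) ∧
  (∀ i k, ¬(i ≤ n ∧ 1 ≤ k ∧ k ≤ n + 1 - i) → g i k = 0)

/-- `ς_λ(g)`: the sequence with `x_j^{(i)} = y_j^{(i)} - λ_{i+j}` for
`1 ≤ i ≤ n`, `1 ≤ j ≤ n+1-i`, and `0` otherwise. -/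
def varsig (n : ℕ) (lam : ℕ → ℤ) (g : ℕ → ℕ → ℤ) : ℕ → ℤ := fun p =>
  if p = 0 then 0
  else if (p - 1) % n + 1 + ((p - 1) / n + 1) ≤ n + 1 then
    g ((p - 1) % n + 1) ((p - 1) / n + 1) - lam ((p - 1) % n + 1 + ((p - 1) / n + 1))
  else 0

/-- `σ_j^{(i)}(g) = y_j^{(i)} + 2 Σ_{k=j+1}^{n+1-i} y_k^{(i)} - Σ_{k=j}^{n-i} y_k^{(i+1)}
- Σ_{k=j+1}^{n+2-i} y_k^{(i-1)}`, with the conventions `y_0^{(i)} = 0` and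
out-of-range entries equal to `0`. -/
def sigGT (n : ℕ) (g : ℕ → ℕ → ℤ) (i j : ℕ) : ℤ :=
  (if 1 ≤ j ∧ j ≤ n + 1 - i then g i j else 0)
  + 2 * ∑ k ∈ Finset.Icc (j + 1) (n + 1 - i), g i k
  - ∑ k ∈ Finset.Icc (max j 1) (n - i), g (i + 1) k
  - ∑ k ∈ Finset.Icc (j + 1) (n + 2 - i), g (i - 1) k

/-- The array obtained from `g` by replacing `y_v^{(i)}` with `y_v^{(i)} + d`. -/
def gUpdate (g : ℕ → ℕ → ℤ) (i v : ℕ) (d : ℤ) : ℕ → ℕ → ℤ :=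
  fun i' k => if i' = i ∧ k = v then g i v + d else g i' k

/-- The z-array `Z_g` associated with `g ∈ GT_λ`:
`z(m,k) = y_{n+2-m-k}^{(k)} - y_{n+3-m-k}^{(k-1)}`. -/
def Zg (n : ℕ) (g : ℕ → ℕ → ℤ) (m k : ℕ) : ℤ :=
  if 1 ≤ m ∧ m ≤ n ∧ 1 ≤ k ∧ k ≤ n + 1 - m then
    g k (n + 2 - m - k) - g (k - 1) (n + 3 - m - k)
  else 0

/-- The expression `x_j^{(i)} - x_j^{(i+1)} + 2 Σ_{k=j+1}^{n+1-i} x_k^{(i)}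
- Σ_{k=j+1}^{n+2-i} x_k^{(i-1)} - Σ_{k=j+1}^{n-i} x_k^{(i+1)}`
(with `x^{(0)} = x^{(n+1)} = 0`). -/
def sigExpr (n : ℕ) (x : ℕ → ℤ) (i j : ℕ) : ℤ :=
  Xc n x i j - Xc n x (i + 1) j
  + 2 * ∑ k ∈ Finset.Icc (j + 1) (n + 1 - i), Xc n x i k
  - ∑ k ∈ Finset.Icc (j + 1) (n + 2 - i), Xc n x (i - 1) k
  - ∑ k ∈ Finset.Icc (j + 1) (n - i), Xc n x (i + 1) k

theorem aux_sum (f : ℕ → ℤ) (a b : ℕ) (h : ∀ k, b < k → f k = 0) :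
    ∑ k ∈ Finset.Icc a b, f k = f a + ∑ k ∈ Finset.Icc (a + 1) b, f k := by
  rcases le_or_gt a b with hab | hab
  · rw [← Finset.sum_erase_add _ _ (Finset.left_mem_Icc.mpr hab), add_comm]
    congr 1
    apply Finset.sum_congr _ (fun _ _ => rfl)
    ext k
    simp only [Finset.mem_erase, Finset.mem_Icc]
    omega
  · rw [Finset.Icc_eq_empty (by omega), Finset.Icc_eq_empty (by omega), h a hab]
    simp

theorem aux_col (n j c : ℕ) (hc1 : 1 ≤ c) (hcn : c ≤ n) : col n (j * n + c) = c := by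
  unfold col
  have h : j * n + c - 1 = (c - 1) + j * n := by omega
  rw [h, Nat.add_mul_mod_self_right, Nat.mod_eq_of_lt (by omega)]
  omega

/-- extended entries -/
def hh (n : ℕ) (lam : ℕ → ℤ) (g : ℕ → ℕ → ℤ) (c j : ℕ) : ℤ :=
  g c j - (if c + j ≤ n + 1 then lam (c + j) else 0)

theorem aux_x (n : ℕ) (lam : ℕ → ℤ) (g : ℕ → ℕ → ℤ) (hg : IsGT n lam g) (j c : ℕ)
    (hc1 : 1 ≤ c) (hcn : c ≤ n) :
    varsig n lam g (j * n + c) = hh n lam g c (j + 1) := by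
  unfold varsig hh
  have h : j * n + c - 1 = (c - 1) + j * n := by omega
  have h1 : (j * n + c - 1) % n + 1 = c := by
    rw [h, Nat.add_mul_mod_self_right, Nat.mod_eq_of_lt (by omega)]
    omega
  have h2 : (j * n + c - 1) / n = j := by
    rw [h, Nat.add_mul_div_right _ _ (by omega), Nat.div_eq_of_lt (by omega)]
    omega
  rw [if_neg (by omega), h1, h2]
  split_ifs with h3
  · rfl
  · rw [hg.2.2.2 c (j + 1) (by omega)]
    rfl

theorem aux_h0 (n : ℕ) (lam : ℕ → ℤ) (g : ℕ → ℕ → ℤ) (hg : IsGT n lam g) (j : ℕ)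
    (hj : 1 ≤ j) : hh n lam g 0 j = 0 := by
  unfold hh
  split_ifs with h
  · rw [hg.2.1 j hj (by omega)]
    simp
  · rw [hg.2.2.2 0 j (by omega)]
    rfl

theorem aux_h1 (n : ℕ) (lam : ℕ → ℤ) (g : ℕ → ℕ → ℤ) (hg : IsGT n lam g) (j : ℕ)
    (hj : 1 ≤ j) : hh n lam g (n + 1) j = 0 := by
  unfold hh
  rw [if_neg (by omega), hg.2.2.2 (n + 1) j (by omega)]
  rfl

/-- The sum over one period. -/
theorem aux_block (n : ℕ) (x : ℕ → ℤ) (j i : ℕ) (hi1 : 1 ≤ i) (hin : i ≤ n) :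
    ∑ l ∈ Finset.Ioc (j * n + i) ((j + 1) * n + i), coef i (col n l) * x l
      = 2 * x ((j + 1) * n + i) - (if i < n then x (j * n + (i + 1)) else 0)
        - (if 1 < i then x ((j + 1) * n + (i - 1)) else 0) := by
  have hjn : (j + 1) * n = j * n + n := by ring
  have key : ∀ l ∈ Finset.Ioc (j * n + i) ((j + 1) * n + i), coef i (col n l) * x l
      = (if l = (j + 1) * n + i then 2 * x l else 0)
        - (if l = j * n + (i + 1) then (if i < n then x l else 0) else 0)
        - (if l = (j + 1) * n + (i - 1) then (if 1 < i then x l else 0) else 0) := by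
    intro l hl
    rw [Finset.mem_Ioc] at hl
    have : (l ≤ (j + 1) * n ∧ col n l = l - j * n) ∨
        ((j + 1) * n < l ∧ col n l = l - (j + 1) * n) := by
      rcases le_or_gt l ((j + 1) * n) with h | h
      · left
        refine ⟨h, ?_⟩
        have h2 := aux_col n j (l - j * n) (by omega) (by omega)
        rwa [show j * n + (l - j * n) = l by omega] at h2
      · right
        refine ⟨h, ?_⟩
        have h2 := aux_col n (j + 1) (l - (j + 1) * n) (by omega) (by omega)
        rwa [show (j + 1) * n + (l - (j + 1) * n) = l by omega] at h2
    rw [hjn] at *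
    generalize j * n = q at *
    unfold coef
    rcases this with ⟨h, hc⟩ | ⟨h, hc⟩ <;> rw [hc] <;> split_ifs <;> first | omega | ring
  rw [Finset.sum_congr rfl key, Finset.sum_sub_distrib, Finset.sum_sub_distrib,
    Finset.sum_ite_eq', Finset.sum_ite_eq', Finset.sum_ite_eq']
  simp only [Finset.mem_Ioc, hjn]
  generalize j * n = q at *
  split_ifs <;> first | omega | ring

theorem aux_first (n : ℕ) (x : ℕ → ℤ) (i : ℕ) (hi1 : 1 ≤ i) (hin : i ≤ n) :
    ∑ l ∈ Finset.Ioc 0 i, coef i (col n l) * x l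
      = 2 * x i - (if 1 < i then x (i - 1) else 0) := by
  have key : ∀ l ∈ Finset.Ioc 0 i, coef i (col n l) * x l
      = (if l = i then 2 * x l else 0) - (if l = i - 1 then (if 1 < i then x l else 0) else 0) := by
    intro l hl
    rw [Finset.mem_Ioc] at hl
    have h2 := aux_col n 0 l (by omega) (by omega)
    rw [show 0 * n + l = l by omega] at h2
    rw [h2]
    unfold coef
    split_ifs <;> first | omega | ring
  rw [Finset.sum_congr rfl key, Finset.sum_sub_distrib,
    Finset.sum_ite_eq', Finset.sum_ite_eq']
  simp only [Finset.mem_Ioc]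
  split_ifs <;> first | omega | ring

theorem aux_sig_step (n : ℕ) (lam : ℕ → ℤ) (g : ℕ → ℕ → ℤ) (hg : IsGT n lam g) (j i : ℕ)
    (hi1 : 1 ≤ i) (hin : i ≤ n) (hj : j < n) :
    sig n (varsig n lam g) (j * n + i) = sig n (varsig n lam g) ((j + 1) * n + i)
      + (hh n lam g i (j + 1) + hh n lam g i (j + 2) - hh n lam g (i + 1) (j + 1)
        - hh n lam g (i - 1) (j + 2)) := by
  have hle : (j + 1) * n + i ≤ n * n + n := by
    have : (j + 1) * n ≤ n * n := Nat.mul_le_mul_right n hj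
    omega
  have hle0 : j * n + i ≤ (j + 1) * n + i := by
    have : (j + 1) * n = j * n + n := by ring
    omega
  unfold sig
  rw [aux_col n j i hi1 hin, aux_col n (j + 1) i hi1 hin,
    ← Finset.sum_Ioc_consecutive _ hle0 hle, aux_block n _ j i hi1 hin,
    aux_x n lam g hg j i hi1 hin, aux_x n lam g hg (j + 1) i hi1 hin]
  have e1 : (if i < n then varsig n lam g (j * n + (i + 1)) else 0)
      = hh n lam g (i + 1) (j + 1) := by
    split_ifs with h
    · rw [aux_x n lam g hg j (i + 1) (by omega) (by omega)]
    · rw [show i = n by omega, aux_h1 n lam g hg _ (by omega)]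
  have e2 : (if 1 < i then varsig n lam g ((j + 1) * n + (i - 1)) else 0)
      = hh n lam g (i - 1) (j + 2) := by
    split_ifs with h
    · rw [aux_x n lam g hg (j + 1) (i - 1) (by omega) (by omega)]
    · rw [show i - 1 = 0 by omega, aux_h0 n lam g hg _ (by omega)]
  rw [e1, e2]
  ring

theorem aux_GT_step (n : ℕ) (lam : ℕ → ℤ) (g : ℕ → ℕ → ℤ) (hg : IsGT n lam g) (j i : ℕ)
    (hi1 : 1 ≤ i) (hin : i ≤ n) :
    sigGT n g i (j + 1) = sigGT n g i (j + 2)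
      + (g i (j + 1) + g i (j + 2) - g (i + 1) (j + 1) - g (i - 1) (j + 2)) := by
  have hz := hg.2.2.2
  unfold sigGT
  have e : ∀ m, (if 1 ≤ m ∧ m ≤ n + 1 - i then g i m else 0) = g i m := by
    intro m
    split_ifs with h
    · rfl
    · rw [hz i m (by omega)]
  rw [e, e, max_eq_left (by omega), max_eq_left (by omega),
    aux_sum (g i) (j + 1 + 1) _ (fun k hk => hz _ _ (by omega)),
    aux_sum (g (i + 1)) (j + 1) _ (fun k hk => hz _ _ (by omega)),
    aux_sum (g (i - 1)) (j + 1 + 1) _ (fun k hk => hz _ _ (by omega))]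
  ring

theorem aux_GT_top (n : ℕ) (lam : ℕ → ℤ) (g : ℕ → ℕ → ℤ) (i : ℕ)
    (hi1 : 1 ≤ i) : sigGT n g i (n + 1) = 0 := by
  unfold sigGT
  rw [if_neg (by omega), Finset.Icc_eq_empty (by omega), Finset.Icc_eq_empty (by omega),
    Finset.Icc_eq_empty (by omega)]
  simp

theorem aux_sig_top (n : ℕ) (lam : ℕ → ℤ) (g : ℕ → ℕ → ℤ) (hg : IsGT n lam g) (i : ℕ)
    (hi1 : 1 ≤ i) (hin : i ≤ n) : sig n (varsig n lam g) (n * n + i) = 0 := by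
  have hv : ∀ c, 1 ≤ c → c ≤ n → varsig n lam g (n * n + c) = 0 := by
    intro c h1 h2
    rw [aux_x n lam g hg n c h1 h2]
    unfold hh
    rw [if_neg (by omega), hg.2.2.2 c (n + 1) (by omega)]
    rfl
  unfold sig
  rw [hv i hi1 hin, Finset.sum_eq_zero]
  · rfl
  · intro l hl
    rw [Finset.mem_Ioc] at hl
    have := hv (l - n * n) (by omega) (by omega)
    rw [show n * n + (l - n * n) = l by omega] at this
    rw [this, mul_zero]

theorem aux_eq (n : ℕ) (lam : ℕ → ℤ) (g : ℕ → ℕ → ℤ) (hg : IsGT n lam g) (i : ℕ)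
    (hi1 : 1 ≤ i) (hin : i ≤ n) (d : ℕ) : ∀ j, j + d = n →
    sig n (varsig n lam g) (j * n + i) = sigGT n g i (j + 1) := by
  induction d with
  | zero =>
    intro j hj
    rw [show j = n by omega, aux_sig_top n lam g hg i hi1 hin, aux_GT_top n lam g i hi1]
  | succ d ih =>
    intro j hj
    rw [aux_sig_step n lam g hg j i hi1 hin (by omega), aux_GT_step n lam g hg j i hi1 hin,
      ih (j + 1) (by omega)]
    unfold hh
    rw [show i - 1 + (j + 2) = i + (j + 1) by omega, show i + 1 + (j + 1) = i + (j + 2) by omega]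
    ring

theorem aux_GT_nonneg (n : ℕ) (hn : 1 ≤ n) (lam : ℕ → ℤ) (hlam : IsShape n lam)
    (g : ℕ → ℕ → ℤ) (hg : IsGT n lam g) (i : ℕ)
    (hi1 : 1 ≤ i) (hin : i ≤ n) : 0 ≤ sigGT n g i n := by
  obtain ⟨m, rfl⟩ : ∃ m, n = m + 1 := ⟨n - 1, by omega⟩
  rw [aux_GT_step _ lam g hg m i hi1 hin, aux_GT_top _ lam g i hi1]
  rw [hg.2.2.2 i (m + 2) (by omega), hg.2.2.2 (i + 1) (m + 1) (by omega)]
  have h0 : g (i - 1) (m + 2) = 0 := by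
    rcases Nat.lt_or_ge 1 i with h | h
    · exact hg.2.2.2 _ _ (by omega)
    · rw [show i - 1 = 0 by omega, hg.2.1 _ (by omega) (by omega)]
      exact hlam.2
  have h1 : 0 ≤ g i (m + 1) := by
    by_cases h : m + 1 ≤ m + 1 + 1 - i
    · exact hg.1 _ _ hin (by omega) h
    · rw [hg.2.2.2 _ _ (by omega)]
  omega

theorem aux_sigma0 (n : ℕ) (lam : ℕ → ℤ)
    (g : ℕ → ℕ → ℤ) (hg : IsGT n lam g) (i : ℕ)
    (hi1 : 1 ≤ i) (hin : i ≤ n) :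
    sigma0 n lam (varsig n lam g) i ≤ sig n (varsig n lam g) (0 * n + i) := by
  have hc := aux_col n 0 i hi1 hin
  have hxi := aux_x n lam g hg 0 i hi1 hin
  have hI : Finset.Icc 1 (n * n + n) = Finset.Ioc 0 (n * n + n) := by
    ext k
    simp only [Finset.mem_Icc, Finset.mem_Ioc]
    omega
  have e2 : (if 1 < i then varsig n lam g (i - 1) else 0) = hh n lam g (i - 1) 1 := by
    split_ifs with h
    · have := aux_x n lam g hg 0 (i - 1) (by omega) (by omega)
      rwa [show 0 * n + (i - 1) = i - 1 by omega] at this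
    · rw [show i - 1 = 0 by omega, aux_h0 n lam g hg _ (by omega)]
  rw [show 0 * n + i = i by omega] at *
  unfold sigma0 sig
  rw [hc, hI, ← Finset.sum_Ioc_consecutive _ (Nat.zero_le i)
    (show i ≤ n * n + n by omega), aux_first n _ i hi1 hin, e2, hxi]
  have := (hg.2.2.1 i 1 hi1 hin le_rfl (by omega)).1
  unfold hh
  rw [if_pos (by omega), if_pos (by omega), show i - 1 + 1 = i by omega]
  simp only [Nat.zero_add]
  linarith

/-- for `g ∈ GT_λ` and `x = ς_λ(g)`,
`max_{1 ≤ j ≤ n} σ_j^{(i)}(g) = σ^{(i)}(x)` and consequently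
`max(σ^{(i)}(x), σ_0^{(i)}(x)) = max_{1 ≤ j ≤ n} σ_j^{(i)}(g)`. -/
theorem stmt10 (n : ℕ) (hn : 1 ≤ n) (lam : ℕ → ℤ) (hlam : IsShape n lam)
    (g : ℕ → ℕ → ℤ) (hg : IsGT n lam g) (x : ℕ → ℤ) (hx : x = varsig n lam g)
    (i : ℕ) (hi1 : 1 ≤ i) (hin : i ≤ n) :
    Finset.sup' (Finset.Icc 1 n) (Finset.nonempty_Icc.mpr hn) (sigGT n g i)
        = sigmaI n x i ∧
    max (sigmaI n x i) (sigma0 n lam x i)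
        = Finset.sup' (Finset.Icc 1 n) (Finset.nonempty_Icc.mpr hn) (sigGT n g i) := by
  subst hx
  have hE : ∀ j, 1 ≤ j → j ≤ n + 1 →
      sig n (varsig n lam g) ((j - 1) * n + i) = sigGT n g i j := by
    intro j h1 h2
    have := aux_eq n lam g hg i hi1 hin (n - (j - 1)) (j - 1) (by omega)
    rwa [show j - 1 + 1 = j by omega] at this
  have hmain : Finset.sup' (Finset.Icc 1 n) (Finset.nonempty_Icc.mpr hn) (sigGT n g i)
      = sigmaI n (varsig n lam g) i := by
    unfold sigmaI
    apply le_antisymm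
    · apply Finset.sup'_le
      intro j hj
      rw [Finset.mem_Icc] at hj
      rw [← hE j hj.1 (by omega)]
      exact Finset.le_sup' (fun j => sig n (varsig n lam g) ((j - 1) * n + i))
        (Finset.mem_Icc.mpr ⟨hj.1, by omega⟩)
    · apply Finset.sup'_le
      intro j hj
      rw [Finset.mem_Icc] at hj
      rw [hE j hj.1 hj.2]
      rcases Nat.lt_or_ge n j with h | h
      · rw [show j = n + 1 by omega, aux_GT_top n lam g i hi1]
        exact le_trans (aux_GT_nonneg n hn lam hlam g hg i hi1 hin)
          (Finset.le_sup' (sigGT n g i) (Finset.mem_Icc.mpr ⟨hn, le_rfl⟩))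
      · exact Finset.le_sup' (sigGT n g i) (Finset.mem_Icc.mpr ⟨hj.1, h⟩)
  refine ⟨hmain, ?_⟩
  rw [hmain]
  apply max_eq_left
  refine le_trans (aux_sigma0 n lam g hg i hi1 hin) ?_
  unfold sigmaI
  exact Finset.le_sup' (fun j => sig n (varsig n lam g) ((j - 1) * n + i))
    (Finset.mem_Icc.mpr ⟨le_rfl, by omega⟩)

end PolyReal
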